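/- Let (R,m) be a Noetherian local normal domain and I ⊆ R an ideal of pure height 1 such that I^n R_P = I^{(n)} R_P for all n and all non-maximal primes P. Then for every n ≥ 1 the module I^{(n)}/\overline{I^n} has finite length, and consequently H^i_m(R/\overline{I^n}) ≅ H^i_m(R/I^{(n)}) for all i ≥ 1. -/

import Mathlib

open IsLocalRing

noncomputable section


/-- `r` is integral over the ideal `J`. -/
def memIntCl {R : Type} [CommRing R] (J : Ideal R) (r : R) : Prop :=
  ∃ t : ℕ, 0 < t ∧ ∃ a : ℕ → R, (∀ j, 1 ≤ j → j ≤ t → a j ∈ J ^ j) ∧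
    r ^ t + ∑ j ∈ Finset.Icc 1 t, a j * r ^ (t - j) = 0

/-- `J` is a reduction of `I`. -/
def Ideal.IsReductionOf {R : Type} [CommRing R] (J I : Ideal R) : Prop :=
  J ≤ I ∧ ∃ n : ℕ, I ^ (n + 1) = J * I ^ n

/-- Height of an ideal. -/
def idealHeight {R : Type} [CommRing R] (I : Ideal R) : ℕ∞ :=
  ⨅ (p : PrimeSpectrum R) (_ : I ≤ p.asIdeal), Order.height p

/-- Depth of a module over a local ring, via weakly regular sequences in the maximal ideal. -/
def moduleDepth (R M : Type) [CommRing R] [IsLocalRing R] [AddCommGroup M] [Module R M] : ℕ∞ :=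
  sSup {n : ℕ∞ | ∃ rs : List R, (rs.length : ℕ∞) = n ∧ (∀ r ∈ rs, r ∈ maximalIdeal R) ∧
    RingTheory.Sequence.IsWeaklyRegular M rs}

/-- Cohen–Macaulay local ring. -/
def IsCMLocalRing (R : Type) [CommRing R] [IsLocalRing R] : Prop :=
  (moduleDepth R R : WithBot ℕ∞) = ringKrullDim R

/-- Regular local ring. -/
def IsRegLocal (R : Type) [CommRing R] [IsLocalRing R] : Prop :=
  IsNoetherianRing R ∧ ∃ s : Finset R, Ideal.span (s : Set R) = maximalIdeal R ∧
    (s.card : WithBot ℕ∞) = ringKrullDim R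

open CategoryTheory in
/-- The Ext module `Ext^n_R(M, N)`. -/
def ExtMod (R : Type) [CommRing R] (n : ℕ) (M N : ModuleCat R) : ModuleCat R :=
  ((Ext R (ModuleCat R) n).obj (Opposite.op M)).obj N

/-- `J` is a canonical ideal of the local ring `R`: `R/J` is Gorenstein of dimension
`dim R - 1`. -/
def IsCanonicalIdeal (R : Type) [CommRing R] [IsLocalRing R] (J : Ideal R) : Prop :=
  J ≠ ⊥ ∧ J ≠ ⊤ ∧ ∃ d' : ℕ,
    ringKrullDim (R ⧸ J) = (d' : WithBot ℕ∞) ∧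
    (d' : WithBot ℕ∞) + 1 = ringKrullDim R ∧
    moduleDepth R (R ⧸ J) = (d' : ℕ∞) ∧
    Nonempty ((ExtMod R d' (ModuleCat.of R (ResidueField R)) (ModuleCat.of R (R ⧸ J))) ≅
      ModuleCat.of R (ResidueField R))

/-- The `n`-th symbolic power of an ideal `I`: the saturation of `I^n` with respect to
the complement of the union of the minimal primes of `I`. -/
def symb {R : Type} [CommRing R] (I : Ideal R) (n : ℕ) : Ideal R where
  carrier := {r | ∃ s : R, (∀ P ∈ I.minimalPrimes, s ∉ P) ∧ s * r ∈ I ^ n}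
  zero_mem' := ⟨1, fun P hP h1 => hP.1.1.ne_top ((Ideal.eq_top_iff_one P).mpr h1), by simp⟩
  add_mem' := by
    rintro a b ⟨s, hs, h⟩ ⟨t, ht, h'⟩
    refine ⟨s * t, fun P hP hm => ?_, ?_⟩
    · rcases hP.1.1.mem_or_mem hm with h'' | h''
      · exact hs P hP h''
      · exact ht P hP h''
    · have : s * t * (a + b) = t * (s * a) + s * (t * b) := by ring
      rw [this]
      exact add_mem (Ideal.mul_mem_left _ _ h) (Ideal.mul_mem_left _ _ h')
  smul_mem' := by
    rintro c r ⟨s, hs, h⟩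
    refine ⟨s, hs, ?_⟩
    have : s * (c • r) = c * (s * r) := by simp [smul_eq_mul]; ring
    rw [this]
    exact Ideal.mul_mem_left _ _ h

/-- An ideal of pure height one. -/
def PureHeightOne {R : Type} [CommRing R] (I : Ideal R) : Prop :=
  I ≠ ⊥ ∧ I ≠ ⊤ ∧ ∀ P ∈ I.minimalPrimes, idealHeight P = 1

/-- `E` is an injective hull of the residue field of the local ring `R`. -/
def IsInjHullOfResidueField (R E : Type) [CommRing R] [IsLocalRing R] [AddCommGroup E]
    [Module R E] : Prop :=
  Module.Injective R E ∧ ∃ ι : ResidueField R →ₗ[R] E, Function.Injective ι ∧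
    ∀ N : Submodule R E, N ≠ ⊥ → ∃ v ∈ N, v ≠ 0 ∧ v ∈ LinearMap.range ι


section LCHelpers
open CategoryTheory Opposite Limits

theorem homologyUnop_nat {V : Type*} [Category* V] [Abelian V] {ι : Type*} {c : ComplexShape ι}
    {K L : HomologicalComplex Vᵒᵖ c} (φ : K ⟶ L) (i : ι) :
    HomologicalComplex.homologyMap ((HomologicalComplex.unopFunctor V c).map φ.op) i ≫
      (K.homologyUnop i).hom = (L.homologyUnop i).hom ≫ (HomologicalComplex.homologyMap φ i).unop := by
  have h := HomologicalComplex.homologyOp_hom_naturality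
    ((HomologicalComplex.unopFunctor V c).map φ.op) i
  have h2 := congrArg Quiver.Hom.unop h
  exact h2.symm

theorem unop_sq {V : Type*} [Category* V] {A A' B B' : Vᵒᵖ} {E E' : V} (p : A ≅ B) (p' : A' ≅ B')
    (m : B' ⟶ B) (α : A' ⟶ A) (e : E ≅ unop B) (e' : E' ≅ unop B') (μ : E ⟶ E')
    (h1 : α ≫ p.hom = p'.hom ≫ m) (h2 : μ ≫ e'.hom = e.hom ≫ m.unop) :
    α.unop ≫ (p'.unop.symm ≪≫ e'.symm).hom = (p.unop.symm ≪≫ e.symm).hom ≫ μ := by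
  have h1' := congrArg Quiver.Hom.unop h1
  simp only [unop_comp] at h1'
  have h3 : e.inv ≫ μ = m.unop ≫ e'.inv := by
    rw [Iso.inv_comp_eq, ← Category.assoc, ← h2]; simp
  simp only [Iso.trans_hom, Iso.symm_hom, Iso.unop_inv, Category.assoc, h3]
  have h4 : α.unop ≫ p'.inv.unop = p.inv.unop ≫ m.unop := by
    rw [← unop_comp, ← unop_comp]
    congr 1
    rw [Iso.inv_comp_eq, ← Category.assoc, ← h1]; simp
  rw [← Category.assoc, h4, Category.assoc]

variable {R : Type} [CommRing R]

abbrev HC (P : ChainComplex (ModuleCat.{0} R) ℕ) (Y : ModuleCat.{0} R) := P.linearYonedaObj R Y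

def HCpost (P : ChainComplex (ModuleCat.{0} R) ℕ) {Y Y' : ModuleCat.{0} R} (g : Y ⟶ Y') :
    HC P Y ⟶ HC P Y' :=
  (HomologicalComplex.unopFunctor _ _).map ((NatTrans.mapHomologicalComplex
    (NatTrans.rightOp ((linearYoneda R (ModuleCat.{0} R)).map g)) _).app P).op

def HCpre {P Q : ChainComplex (ModuleCat.{0} R) ℕ} (φ : P ⟶ Q) (Y : ModuleCat.{0} R) :
    HC Q Y ⟶ HC P Y :=
  (HomologicalComplex.unopFunctor _ _).map
   (((((linearYoneda R (ModuleCat.{0} R)).obj Y).rightOp.mapHomologicalComplex _).map φ)).op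

theorem HCpost_f (P : ChainComplex (ModuleCat.{0} R) ℕ) {Y Y' : ModuleCat.{0} R} (g : Y ⟶ Y') (n)
   (f : P.X n ⟶ Y) : (HCpost P g).f n f = (f ≫ g : P.X n ⟶ Y') := rfl
theorem HCpre_f {P Q : ChainComplex (ModuleCat.{0} R) ℕ} (φ : P ⟶ Q) (Y : ModuleCat.{0} R) (n)
   (f : Q.X n ⟶ Y) : (HCpre φ Y).f n f = (φ.f n ≫ f : P.X n ⟶ Y) := rfl
theorem HC_d (P : ChainComplex (ModuleCat.{0} R) ℕ) {Y : ModuleCat.{0} R} (m n)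
   (f : P.X n ⟶ Y) : (HC P Y).d n m f = (P.d m n ≫ f : P.X m ⟶ Y) := rfl

theorem isoExt_post {X : ModuleCat.{0} R} (P : ProjectiveResolution X) (n : ℕ)
    {Y Y' : ModuleCat.{0} R} (g : Y ⟶ Y') :
    ((Ext R (ModuleCat.{0} R) n).obj (op X)).map g ≫ (P.isoExt n Y').hom =
      (P.isoExt n Y).hom ≫ HomologicalComplex.homologyMap (HCpost P.complex g) n := by
  have h1 := P.leftDerived_app_eq (NatTrans.rightOp ((linearYoneda R (ModuleCat.{0} R)).map g)) n
  have h2 := homologyUnop_nat ((NatTrans.mapHomologicalComplex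
    (NatTrans.rightOp ((linearYoneda R (ModuleCat.{0} R)).map g)) (ComplexShape.down ℕ)).app P.complex) n
  have h3 : (NatTrans.leftDerived (NatTrans.rightOp ((linearYoneda R (ModuleCat.{0} R)).map g)) n).app X ≫
      (P.isoLeftDerivedObj ((linearYoneda R (ModuleCat R)).obj Y).rightOp n).hom =
      (P.isoLeftDerivedObj ((linearYoneda R (ModuleCat R)).obj Y').rightOp n).hom ≫
      (HomologicalComplex.homologyFunctor (ModuleCat R)ᵒᵖ (ComplexShape.down ℕ) n).map
          ((NatTrans.mapHomologicalComplex (NatTrans.rightOp ((linearYoneda R (ModuleCat R)).map g))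
                (ComplexShape.down ℕ)).app P.complex) := by
    rw [h1, Category.assoc, Category.assoc, Iso.inv_hom_id, Category.comp_id]
  exact unop_sq (P.isoLeftDerivedObj ((linearYoneda R (ModuleCat R)).obj Y).rightOp n)
    (P.isoLeftDerivedObj ((linearYoneda R (ModuleCat R)).obj Y').rightOp n) _ _
    (HomologicalComplex.homologyUnop _ n) (HomologicalComplex.homologyUnop _ n) _ h3 h2

theorem isoExt_pre {X X' : ModuleCat.{0} R} (f : X ⟶ X') (P : ProjectiveResolution X)
    (Q : ProjectiveResolution X')
    (φ : P.complex ⟶ Q.complex) (w : φ.f 0 ≫ Q.π.f 0 = P.π.f 0 ≫ f) (n : ℕ)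
    (Y : ModuleCat.{0} R) :
    ((Ext R (ModuleCat.{0} R) n).map f.op).app Y ≫ (P.isoExt n Y).hom =
      (Q.isoExt n Y).hom ≫ HomologicalComplex.homologyMap (HCpre φ Y) n := by
  have h1 := ProjectiveResolution.isoLeftDerivedObj_hom_naturality f P Q φ w
    ((linearYoneda R (ModuleCat.{0} R)).obj Y).rightOp n
  have h2 := homologyUnop_nat
   (((((linearYoneda R (ModuleCat.{0} R)).obj Y).rightOp.mapHomologicalComplex _).map φ)) n
  exact unop_sq (Q.isoLeftDerivedObj ((linearYoneda R (ModuleCat R)).obj Y).rightOp n)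
    (P.isoLeftDerivedObj ((linearYoneda R (ModuleCat R)).obj Y).rightOp n) _ _
    (HomologicalComplex.homologyUnop _ n) (HomologicalComplex.homologyUnop _ n) _ h1 h2

def CRep (K : CochainComplex (ModuleCat.{0} R) ℕ) (n : ℕ) (x : K.X n) (z : K.homology n) : Prop :=
  ∃ c : K.cycles n, K.iCycles n c = x ∧ K.homologyπ n c = z

theorem CRep.exists (K : CochainComplex (ModuleCat.{0} R) ℕ) (n : ℕ) (z : K.homology n) :
    ∃ x, CRep K n x z := by
  obtain ⟨c, hc⟩ := (ModuleCat.epi_iff_surjective (K.homologyπ n)).1 inferInstance z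
  exact ⟨_, c, rfl, hc⟩

theorem CRep.d {K : CochainComplex (ModuleCat.{0} R) ℕ} {n : ℕ} {x : K.X n} {z : K.homology n}
    (h : CRep K n x z) (m : ℕ) : K.d n m x = 0 := by
  obtain ⟨c, rfl, -⟩ := h
  rw [← ConcreteCategory.comp_apply, K.iCycles_d]; rfl

theorem CRep.of_d (K : CochainComplex (ModuleCat.{0} R) ℕ) (n : ℕ) (x : K.X n)
    (h : K.d n (n+1) x = 0) : ∃ z, CRep K n x z := by
  have hn : (ComplexShape.up ℕ).next n = n + 1 := by simp
  refine ⟨_, K.cyclesMk x (n+1) hn h, K.i_cyclesMk x (n+1) hn h, rfl⟩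

theorem CRep.unique {K : CochainComplex (ModuleCat.{0} R) ℕ} {n : ℕ} {x : K.X n}
    {z z' : K.homology n} (h : CRep K n x z) (h' : CRep K n x z') : z = z' := by
  obtain ⟨c, rfl, rfl⟩ := h
  obtain ⟨c', h, rfl⟩ := h'
  rw [(ModuleCat.mono_iff_injective (K.iCycles n)).1 inferInstance h]

theorem CRep.map {K L : CochainComplex (ModuleCat.{0} R) ℕ} {n : ℕ} {x : K.X n}
    {z : K.homology n} (h : CRep K n x z) (ψ : K ⟶ L) :
    CRep L n (ψ.f n x) (HomologicalComplex.homologyMap ψ n z) := by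
  obtain ⟨c, rfl, rfl⟩ := h
  refine ⟨HomologicalComplex.cyclesMap ψ n c, ?_, ?_⟩
  · rw [← ConcreteCategory.comp_apply, HomologicalComplex.cyclesMap_i]; rfl
  · rw [← ConcreteCategory.comp_apply, ← HomologicalComplex.homologyπ_naturality]; rfl

theorem CRep.zero_iff {K : CochainComplex (ModuleCat.{0} R) ℕ} {n : ℕ} {x : K.X (n+1)}
    {z : K.homology (n+1)} (h : CRep K (n+1) x z) : z = 0 ↔ ∃ y, K.d n (n+1) y = x := by
  obtain ⟨c, rfl, rfl⟩ := h
  constructor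
  · intro h
    have hS : (ShortComplex.mk _ _ (K.toCycles_comp_homologyπ n (n+1))).Exact :=
      ShortComplex.exact_of_g_is_cokernel _ (K.homologyIsCokernel n (n+1) (by simp))
    rw [ShortComplex.moduleCat_exact_iff] at hS
    obtain ⟨y, hy⟩ := hS c h
    refine ⟨y, ?_⟩
    rw [← hy]
    dsimp
    rw [← ConcreteCategory.comp_apply, HomologicalComplex.toCycles_i]
  · rintro ⟨y, hy⟩
    have : K.toCycles n (n+1) y = c := by
      apply (ModuleCat.mono_iff_injective (K.iCycles (n+1))).1 inferInstance
      rw [← hy, ← ConcreteCategory.comp_apply, HomologicalComplex.toCycles_i]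
    rw [← this, ← ConcreteCategory.comp_apply, HomologicalComplex.toCycles_comp_homologyπ]
    rfl

def ERep {X : ModuleCat.{0} R} (P : ProjectiveResolution X) (n : ℕ) {Y : ModuleCat.{0} R}
    (f : P.complex.X n ⟶ Y) (z : ((Ext R (ModuleCat.{0} R) n).obj (op X)).obj Y) : Prop :=
  CRep (HC P.complex Y) n f ((P.isoExt n Y).hom z)

section
variable {X X' : ModuleCat.{0} R} (P : ProjectiveResolution X) (Q : ProjectiveResolution X')
  {n : ℕ} {Y Y' : ModuleCat.{0} R}

theorem ERep.exists (z : ((Ext R (ModuleCat.{0} R) n).obj (op X)).obj Y) : ∃ f, ERep P n f z :=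
  CRep.exists (HC P.complex Y) n ((P.isoExt n Y).hom z)

variable {P}

theorem ERep.d {f : P.complex.X n ⟶ Y} {z} (h : ERep P n f z) :
    P.complex.d (n+1) n ≫ f = 0 := CRep.d h (n+1)

theorem ERep.of_d {f : P.complex.X n ⟶ Y} (h : P.complex.d (n+1) n ≫ f = 0) :
    ∃ z, ERep P n f z := by
  obtain ⟨z, hz⟩ := CRep.of_d (HC P.complex Y) n f h
  refine ⟨(P.isoExt n Y).inv z, ?_⟩
  unfold ERep
  rwa [← ConcreteCategory.comp_apply, Iso.inv_hom_id, ConcreteCategory.id_apply]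

theorem ERep.unique {f : P.complex.X n ⟶ Y} {z z'} (h : ERep P n f z) (h' : ERep P n f z') :
    z = z' :=
  (ModuleCat.mono_iff_injective (P.isoExt n Y).hom).1 inferInstance (CRep.unique h h')

theorem ERep.post {f : P.complex.X n ⟶ Y} {z} (h : ERep P n f z) (g : Y ⟶ Y') :
    ERep P n (f ≫ g) (((Ext R (ModuleCat.{0} R) n).obj (op X)).map g z) := by
  have h1 := CRep.map h (HCpost P.complex g)
  rw [← ConcreteCategory.comp_apply, ← isoExt_post, ConcreteCategory.comp_apply] at h1
  exact h1

theorem ERep.pre {f : P.complex.X n ⟶ Y} {z} (h : ERep P n f z) (u : X' ⟶ X)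
    (φ : Q.complex ⟶ P.complex) (w : φ.f 0 ≫ P.π.f 0 = Q.π.f 0 ≫ u) :
    ERep Q n (φ.f n ≫ f) (((Ext R (ModuleCat.{0} R) n).map u.op).app Y z) := by
  have h1 := CRep.map h (HCpre φ Y)
  rw [← ConcreteCategory.comp_apply, ← isoExt_pre u Q P φ w, ConcreteCategory.comp_apply] at h1
  exact h1

theorem ERep.zero_iff {f : P.complex.X (n+1) ⟶ Y} {z} (h : ERep P (n+1) f z) :
    z = 0 ↔ ∃ g : P.complex.X n ⟶ Y, P.complex.d (n+1) n ≫ g = f := by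
  have h1 := CRep.zero_iff h
  have h2 : (P.isoExt (n+1) Y).hom z = 0 ↔ z = 0 :=
    map_eq_zero_iff (P.isoExt (n+1) Y).hom.hom
      ((ModuleCat.mono_iff_injective (P.isoExt (n+1) Y).hom).1 inferInstance)
  rw [← h2]
  exact h1
end

section
variable (J : Ideal R)

abbrev XJ (t : ℕ) : ModuleCat.{0} R := ModuleCat.of R (R ⧸ J ^ t)
def trJ {t s : ℕ} (h : t ≤ s) : XJ J s ⟶ XJ J t :=
  ModuleCat.ofHom (Submodule.mapQ _ _ LinearMap.id (Ideal.pow_le_pow_right h))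
noncomputable abbrev PJ (t : ℕ) : ProjectiveResolution (XJ J t) := projectiveResolution (XJ J t)
noncomputable abbrev phJ {t s : ℕ} (h : t ≤ s) : (PJ J s).complex ⟶ (PJ J t).complex :=
  ProjectiveResolution.lift (trJ J h) _ _

noncomputable def augJ (t : ℕ) : (PJ J t).complex.X 0 ⟶ XJ J t := (PJ J t).π.f 0

theorem augJ_d (t j : ℕ) : (PJ J t).complex.d j 0 ≫ augJ J t = 0 := by
  have h := (PJ J t).π.comm j 0
  refine h.symm.trans ?_
  simp
  exact comp_zero

theorem augJ_desc (t : ℕ) {Y : ModuleCat.{0} R} (f : (PJ J t).complex.X 0 ⟶ Y)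
    (hf : (PJ J t).complex.d 1 0 ≫ f = 0) : ∃ h : XJ J t ⟶ Y, augJ J t ≫ h = f :=
  ⟨(PJ J t).exact₀.desc f hf, (PJ J t).exact₀.g_desc _ _⟩

theorem augJ_nat {t s : ℕ} (h : t ≤ s) : (phJ J h).f 0 ≫ augJ J t = augJ J s ≫ trJ J h :=
  ProjectiveResolution.lift_commutes_zero _ _ _

def TorsJ (K : Type) [AddCommGroup K] [Module R K] : Prop :=
  ∀ x : K, ∃ k, ∀ a ∈ J ^ k, a • x = 0

/-- The submodule of elements killed by a power of `J`. -/
def GamJ (E : Type) [AddCommGroup E] [Module R E] : Submodule R E where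
  carrier := {x | ∃ k, ∀ a ∈ J ^ k, a • x = 0}
  zero_mem' := ⟨0, fun a _ => smul_zero a⟩
  add_mem' := by
    rintro x y ⟨k, hk⟩ ⟨l, hl⟩
    refine ⟨max k l, fun a ha => ?_⟩
    rw [smul_add, hk a (Ideal.pow_le_pow_right (le_max_left _ _) ha),
      hl a (Ideal.pow_le_pow_right (le_max_right _ _) ha), add_zero]
  smul_mem' := by
    rintro c x ⟨k, hk⟩
    refine ⟨k, fun a ha => ?_⟩
    rw [smul_comm, hk a ha, smul_zero]

theorem tors_uniform {A E : Type} [AddCommGroup A] [Module R A] [Module.Finite R A]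
    [AddCommGroup E] [Module R E] (hE : TorsJ J E) (φ : A →ₗ[R] E) :
    ∃ c, ∀ a ∈ J ^ c, ∀ x, a • φ x = 0 := by
  obtain ⟨T, hT⟩ := (Module.Finite.fg_top : (⊤ : Submodule R A).FG)
  choose k hk using fun x => hE (φ x)
  refine ⟨T.sup k, fun a ha x => ?_⟩
  have hx : x ∈ Submodule.span R (T : Set A) := hT ▸ trivial
  induction hx using Submodule.span_induction with
  | mem y hy => exact hk y a (Ideal.pow_le_pow_right (Finset.le_sup hy) ha)
  | zero => simp
  | add y z _ _ hy hz => rw [map_add, smul_add, hy, hz, add_zero]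
  | smul r y _ hy => rw [map_smul, smul_comm, hy, smul_zero]

theorem artin_rees_kill [IsNoetherianRing R] (𝔞 : Ideal R) (c : ℕ) :
    ∃ s, ∀ x ∈ 𝔞, x ∈ J ^ s → x ∈ J ^ c * 𝔞 := by
  obtain ⟨k, hk⟩ := Ideal.exists_pow_inf_eq_pow_smul J (𝔞 : Submodule R R)
  refine ⟨k + c, fun x hx hxs => ?_⟩
  have h := hk (k + c) (Nat.le_add_right _ _)
  have hm : x ∈ J ^ (k+c) • (⊤ : Submodule R R) ⊓ 𝔞 := by
    refine ⟨?_, hx⟩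
    rw [← mul_one x, ← smul_eq_mul]
    exact Submodule.smul_mem_smul hxs trivial
  rw [h, Nat.add_sub_cancel_left] at hm
  exact Submodule.smul_mono le_rfl inf_le_right hm

theorem gam_baer [IsNoetherianRing R] (E : Type) [AddCommGroup E] [Module R E]
    (hE : Module.Baer R E) : Module.Baer R (GamJ J E) := by
  intro 𝔞 φ
  have hT : TorsJ J (GamJ J E) := by
    rintro ⟨x, k, hk⟩
    exact ⟨k, fun a ha => Subtype.ext (hk a ha)⟩
  obtain ⟨c, hc⟩ := tors_uniform J hT φ
  obtain ⟨s, hs⟩ := artin_rees_kill J 𝔞 c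
  let f : 𝔞 →ₗ[R] (R ⧸ J ^ s) := (Submodule.mkQ (J ^ s)).comp (Submodule.subtype 𝔞)
  let ψ : 𝔞 →ₗ[R] E := (GamJ J E).subtype ∘ₗ φ
  have hker : LinearMap.ker f ≤ LinearMap.ker ψ := by
    intro x hx
    have h1 : (x : R) ∈ J ^ s := (Submodule.Quotient.mk_eq_zero _).1 hx
    have h2 := hs x x.2 h1
    have h3 : J ^ c * 𝔞 ≤ (LinearMap.ker ψ).map (Submodule.subtype 𝔞) := by
      rw [Ideal.mul_le]
      intro a ha b hb
      refine ⟨a • ⟨b, hb⟩, ?_, rfl⟩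
      change ((φ (a • ⟨b, hb⟩) : GamJ J E) : E) = 0
      rw [map_smul, hc a ha]
      rfl
    obtain ⟨y, hy, hyx⟩ := h3 h2
    have : y = x := Subtype.ext hyx
    exact this ▸ hy
  obtain ⟨h, hh⟩ := hE.extension_property ((LinearMap.ker f).liftQ f le_rfl)
    (LinearMap.ker_eq_bot.1 (Submodule.ker_liftQ_eq_bot _ _ _ le_rfl))
    ((LinearMap.ker f).liftQ ψ hker)
  have hmem : ∀ r : R, (h ∘ₗ Submodule.mkQ (J ^ s)) r ∈ GamJ J E := by
    intro r
    refine ⟨s, fun a ha => ?_⟩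
    rw [← map_smul, LinearMap.comp_apply,
      (Submodule.Quotient.mk_eq_zero (J^s)).2 (Ideal.mul_mem_right _ _ ha) |> fun e =>
        (show Submodule.mkQ (J^s) (a • r) = 0 from e), map_zero]
  refine ⟨LinearMap.codRestrict _ _ hmem, fun x hx => Subtype.ext ?_⟩
  exact congrArg (fun u => u (Submodule.Quotient.mk ⟨x, hx⟩)) hh

theorem exists_inj_tors [IsNoetherianRing R] (K : ModuleCat.{0} R) (hK : TorsJ J K) :
    ∃ (E : ModuleCat.{0} R) (ι : K ⟶ E), Mono ι ∧ Injective E ∧ TorsJ J E := by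
  let E0 : ModuleCat.{0} R := Injective.under K
  let i : K ⟶ E0 := Injective.ι K
  have hi : Function.Injective i := (ModuleCat.mono_iff_injective i).1 inferInstance
  have hE0 : Module.Injective R E0 :=
    (Module.injective_iff_injective_object R E0).2 (inferInstanceAs (Injective (Injective.under K)))
  have hB := gam_baer J E0 (Module.Baer.of_injective hE0)
  have hmem : ∀ x, i.hom x ∈ GamJ J E0 := by
    intro x
    obtain ⟨k, hk⟩ := hK x
    exact ⟨k, fun a ha => by rw [← map_smul, hk a ha, map_zero]⟩
  refine ⟨ModuleCat.of R (GamJ J E0), ModuleCat.ofHom (i.hom.codRestrict _ hmem), ?_, ?_, ?_⟩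
  · refine (ModuleCat.mono_iff_injective _).2 fun x y hxy => hi (congrArg Subtype.val hxy)
  · exact (Module.injective_iff_injective_object R (GamJ J E0)).1 hB.injective
  · rintro ⟨x, k, hk⟩
    exact ⟨k, fun a ha => Subtype.ext (hk a ha)⟩

theorem lift_surj {M N A : ModuleCat.{0} R} [Projective A] (p : M ⟶ N) (hp : Function.Surjective p)
    (f : A ⟶ N) : ∃ g : A ⟶ M, g ≫ p = f := by
  have : Epi p := (ModuleCat.epi_iff_surjective p).2 hp
  exact ⟨Projective.factorThru f p, Projective.factorThru_comp f p⟩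

theorem lift_ker {K M N A : ModuleCat.{0} R} (i : K ⟶ M) (p : M ⟶ N)
    (hi : Function.Injective i) (hx : ∀ x, p x = 0 → ∃ y, i y = x)
    (f : A ⟶ M) (hf : f ≫ p = 0) : ∃ g : A ⟶ K, g ≫ i = f := by
  have hm : ∀ a, f a ∈ LinearMap.range i.hom := fun a => hx _ (by
    rw [← ConcreteCategory.comp_apply, hf]; rfl)
  let e := LinearEquiv.ofInjective i.hom hi
  refine ⟨ModuleCat.ofHom (e.symm.toLinearMap ∘ₗ f.hom.codRestrict _ hm), ?_⟩
  ext a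
  change i.hom (e.symm ⟨f a, hm a⟩) = f a
  exact congrArg Subtype.val (e.apply_symm_apply ⟨f a, hm a⟩)

theorem key [IsNoetherianRing R] (n : ℕ) : ∀ (K : ModuleCat.{0} R), TorsJ J K → ∀ (t : ℕ)
    (f : (PJ J t).complex.X (n+1) ⟶ K), (PJ J t).complex.d (n+2) (n+1) ≫ f = 0 →
    ∃ (s : ℕ) (h : t ≤ s) (g : (PJ J s).complex.X n ⟶ K),
      (phJ J h).f (n+1) ≫ f = (PJ J s).complex.d (n+1) n ≫ g := by
  induction n with
  | zero => ?_
  | succ m ih => ?_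
  all_goals
    intro K hK t f hf
    obtain ⟨E, ι, hι, hE, hTE⟩ := exists_inj_tors J K hK
    let q : E ⟶ ModuleCat.of R (E ⧸ LinearMap.range ι.hom) :=
      ModuleCat.ofHom (Submodule.mkQ _)
    have hq : Function.Surjective q := Submodule.mkQ_surjective _
    have hιi : Function.Injective ι := (ModuleCat.mono_iff_injective ι).1 hι
    have hιq : ι ≫ q = 0 := by
      ext x
      exact (Submodule.Quotient.mk_eq_zero _).2 ⟨x, rfl⟩
    have hex : ∀ x, q x = 0 → ∃ y, ι y = x := fun x hx =>
      (Submodule.Quotient.mk_eq_zero _).1 hx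
    have hTq : TorsJ J (ModuleCat.of R (E ⧸ LinearMap.range ι.hom)) := by
      intro x
      obtain ⟨e, rfl⟩ := hq x
      obtain ⟨k, hk⟩ := hTE e
      refine ⟨k, fun a ha => ?_⟩
      rw [← map_smul, hk a ha, map_zero]
    have hxe := (PJ J t).exact_succ
    obtain ⟨g, hg⟩ : ∃ g, (PJ J t).complex.d _ _ ≫ g = f ≫ ι :=
      ⟨(hxe _).descToInjective (f ≫ ι) (by dsimp; rw [← Category.assoc, hf, zero_comp]),
        (hxe _).comp_descToInjective _ _⟩
    have hgq := congrArg (· ≫ q) hg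
    simp only [Category.assoc, hιq, comp_zero] at hgq
    suffices H : ∃ (s : ℕ) (h : t ≤ s) (w : (PJ J s).complex.X _ ⟶ E),
        (∀ j, (PJ J s).complex.d j _ ≫ w = 0) ∧ w ≫ q = (phJ J h).f _ ≫ g ≫ q by
      obtain ⟨s, h, w, hw, hwq⟩ := H
      obtain ⟨v, hv⟩ := lift_ker ι q hιi hex ((phJ J h).f _ ≫ g - w) (by
        rw [Preadditive.sub_comp, hwq, Category.assoc, sub_self])
      refine ⟨s, h, v, ?_⟩
      rw [← cancel_mono ι, Category.assoc, Category.assoc, hv, Preadditive.comp_sub, hw, sub_zero,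
        ← hg, HomologicalComplex.Hom.comm_assoc]
  · obtain ⟨h, hh⟩ := augJ_desc J t (g ≫ q) hgq
    obtain ⟨e, he⟩ := hq (h (Submodule.Quotient.mk 1))
    obtain ⟨k, hk⟩ := hTE e
    have hs : t ≤ max t k := le_max_left _ _
    let u : XJ J (max t k) ⟶ E := ModuleCat.ofHom (Submodule.liftQ _ (LinearMap.toSpanSingleton R E e)
      (fun a ha => hk a (Ideal.pow_le_pow_right (le_max_right _ _) ha)))
    have hu : u ≫ q = trJ J hs ≫ h := by
      refine ModuleCat.hom_ext (LinearMap.ext fun x => ?_)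
      obtain ⟨r, rfl⟩ := Submodule.Quotient.mk_surjective _ x
      change q (r • e) = h (Submodule.Quotient.mk r)
      rw [map_smul, he, ← map_smul, ← Submodule.Quotient.mk_smul, smul_eq_mul, mul_one]
    refine ⟨_, hs, augJ J _ ≫ u, ?_, ?_⟩
    · intro j
      rw [← Category.assoc, augJ_d, zero_comp]
    · rw [Category.assoc, hu, ← hh, ← Category.assoc, ← Category.assoc, augJ_nat]
  · obtain ⟨s, h, ub, hub⟩ := ih _ hTq t (g ≫ q) hgq
    obtain ⟨u, rfl⟩ := lift_surj q hq ub
    refine ⟨s, h, (PJ J s).complex.d _ _ ≫ u, ?_, ?_⟩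
    · intro j
      rw [← Category.assoc, HomologicalComplex.d_comp_d, zero_comp]
    · rw [Category.assoc, hub]

theorem lc_bij [IsNoetherianRing R] (n : ℕ) {M N : ModuleCat.{0} R} (p : M ⟶ N)
    (hp : Function.Surjective p) (ht : ∀ x, p x = 0 → ∃ k, ∀ a ∈ J ^ k, a • x = 0) :
    Function.Bijective ((localCohomology J (n+1)).map p) := by
  let K : ModuleCat.{0} R := ModuleCat.of R (LinearMap.ker p.hom)
  let i : K ⟶ M := ModuleCat.ofHom (LinearMap.ker p.hom).subtype
  have hi : Function.Injective i := Subtype.val_injective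
  have hiM : Mono i := (ModuleCat.mono_iff_injective i).2 hi
  have hip : i ≫ p = 0 := by
    ext x; exact x.2
  have hex : ∀ x, p x = 0 → ∃ y, i y = x := fun x hx => ⟨⟨x, hx⟩, rfl⟩
  have hK : TorsJ J K := by
    intro x
    obtain ⟨k, hk⟩ := ht x.1 x.2
    exact ⟨k, fun a ha => Subtype.ext (hk a ha)⟩
  -- surjectivity at finite level
  have S1 : ∀ (t : ℕ) (y : ((Ext R (ModuleCat.{0} R) (n+1)).obj (op (XJ J t))).obj N),
      ∃ (s : ℕ) (h : t ≤ s) (y' : ((Ext R (ModuleCat.{0} R) (n+1)).obj (op (XJ J s))).obj M),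
      ((Ext R (ModuleCat.{0} R) (n+1)).obj (op (XJ J s))).map p y' =
        ((Ext R (ModuleCat.{0} R) (n+1)).map (trJ J h).op).app N y := by
    intro t y
    obtain ⟨f, hf⟩ := ERep.exists (PJ J t) y
    obtain ⟨f', rfl⟩ := lift_surj p hp f
    obtain ⟨f'', hf''⟩ := lift_ker i p hi hex ((PJ J t).complex.d (n+2) (n+1) ≫ f') (by
      rw [Category.assoc, hf.d])
    obtain ⟨s, h, g, hg⟩ := key J (n+1) K hK t f'' (by
      rw [← cancel_mono i, Category.assoc, hf'', ← Category.assoc, HomologicalComplex.d_comp_d,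
        zero_comp, zero_comp])
    obtain ⟨y', hy'⟩ := ERep.of_d (P := PJ J s) (f := (phJ J h).f (n+1) ≫ f' - g ≫ i) (by
      rw [Preadditive.comp_sub, ← Category.assoc _ g, ← hg, Category.assoc, hf'',
        HomologicalComplex.Hom.comm_assoc, sub_self])
    refine ⟨s, h, y', ?_⟩
    have h1 := hy'.post p
    have h2 := hf.pre (PJ J s) (trJ J h) (phJ J h) (ProjectiveResolution.lift_commutes_zero _ _ _)
    rw [Preadditive.sub_comp, Category.assoc, Category.assoc, hip, comp_zero, sub_zero] at h1
    exact h1.unique h2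
  have S2 : ∀ (t : ℕ) (y : ((Ext R (ModuleCat.{0} R) (n+1)).obj (op (XJ J t))).obj M),
      ((Ext R (ModuleCat.{0} R) (n+1)).obj (op (XJ J t))).map p y = 0 →
      ∃ (s : ℕ) (h : t ≤ s), ((Ext R (ModuleCat.{0} R) (n+1)).map (trJ J h).op).app M y = 0 := by
    intro t y hy
    obtain ⟨f, hf⟩ := ERep.exists (PJ J t) y
    obtain ⟨h0, hh0⟩ := (hf.post p).zero_iff.1 hy
    obtain ⟨h1, rfl⟩ := lift_surj p hp h0
    obtain ⟨v, hv⟩ := lift_ker i p hi hex (f - (PJ J t).complex.d (n+1) n ≫ h1) (by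
      rw [Preadditive.sub_comp, Category.assoc, hh0, sub_self])
    obtain ⟨s, h, g, hg⟩ := key J n K hK t v (by
      rw [← cancel_mono i, Category.assoc, hv, Preadditive.comp_sub, hf.d, ← Category.assoc,
        HomologicalComplex.d_comp_d, zero_comp, zero_comp, sub_zero])
    refine ⟨s, h, ?_⟩
    have h2 := hf.pre (PJ J s) (trJ J h) (phJ J h) (ProjectiveResolution.lift_commutes_zero _ _ _)
    refine h2.zero_iff.2 ⟨g ≫ i + (phJ J h).f n ≫ h1, ?_⟩
    rw [Preadditive.comp_add, ← Category.assoc, ← hg, Category.assoc, hv, Preadditive.comp_sub,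
      HomologicalComplex.Hom.comm_assoc, sub_add_cancel]
  let D := localCohomology.diagram (localCohomology.idealPowersDiagram J) (n+1)
  let c := colimit.cocone D
  have hc : IsColimit c := colimit.isColimit D
  have hcM := isColimitOfPreserves ((evaluation _ _).obj M) hc
  have hcN := isColimitOfPreserves ((evaluation _ _).obj N) hc
  have nat : ∀ j (y : (D.obj j).obj M), (c.pt.map p) ((c.ι.app j).app M y) =
      (c.ι.app j).app N ((D.obj j).map p y) := by
    intro j y
    rw [← ConcreteCategory.comp_apply, ← ConcreteCategory.comp_apply, (c.ι.app j).naturality]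
    rfl
  have compat : ∀ {j k} (u : j ⟶ k) (L) (y : (D.obj j).obj L),
      (c.ι.app k).app L ((D.map u).app L y) = (c.ι.app j).app L y := by
    intro j k u L y
    rw [← c.w u]; rfl
  have : IsFiltered ℕᵒᵖᵒᵖ := inferInstance
  change Function.Bijective (c.pt.map p)
  constructor
  · rw [injective_iff_map_eq_zero]
    intro z hz
    obtain ⟨j, y, rfl⟩ := Concrete.isColimit_exists_rep _ hcM z
    have hz' : (c.ι.app j).app N ((D.obj j).map p y) = (c.ι.app j).app N 0 := by
      rw [← nat, map_zero]; exact hz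
    obtain ⟨k, u, v, huv⟩ := Concrete.isColimit_exists_of_rep_eq _ hcN _ _ hz'
    have huv' : (D.obj k).map p ((D.map u).app M y) = 0 := by
      rw [← ConcreteCategory.comp_apply, ← (D.map u).naturality, ConcreteCategory.comp_apply]
      refine huv.trans (map_zero _)
    obtain ⟨s, h, hs⟩ := S2 k.unop.unop _ huv'
    have h3 : (c.ι.app j).app M y = 0 := by
      rw [← compat u, ← compat (homOfLE h).op.op]
      exact (congrArg _ hs).trans (map_zero _)
    exact h3
  · intro z
    obtain ⟨j, y, rfl⟩ := Concrete.isColimit_exists_rep _ hcN z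
    obtain ⟨s, h, y', hy'⟩ := S1 j.unop.unop y
    refine ⟨(c.ι.app (op (op s))).app M y', ?_⟩
    refine (nat (op (op s)) y').trans ?_
    exact (congrArg _ hy').trans (compat (homOfLE h).op.op N y)
end

end LCHelpers

section CAHelpers

theorem dvd_of_intEq {A : Type} [CommRing A] [IsDomain A] [IsIntegrallyClosed A] (g r : A)
    (t : ℕ) (ht : 0 < t) (b : ℕ → A)
    (h : r ^ t + ∑ j ∈ Finset.Icc 1 t, b j * g ^ j * r ^ (t - j) = 0) : g ∣ r := by
  by_cases hg : g = 0
  · subst hg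
    have h0 : ∑ j ∈ Finset.Icc 1 t, b j * (0 : A) ^ j * r ^ (t - j) = 0 := by
      refine Finset.sum_eq_zero fun j hj => ?_
      rw [zero_pow (by have := (Finset.mem_Icc.1 hj).1; omega)]
      ring
    rw [h0, add_zero] at h
    exact zero_dvd_iff.2 (pow_eq_zero_iff (by omega) |>.1 h)
  · let K := FractionRing A
    let φ := algebraMap A K
    have hg' : φ g ≠ 0 := fun h0 => hg (IsFractionRing.injective A K (h0.trans (map_zero φ).symm))
    let p : Polynomial A := Polynomial.X ^ t +
      ∑ j ∈ Finset.Icc 1 t, Polynomial.C (b j) * Polynomial.X ^ (t - j)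
    have hp : p.Monic := by
      refine Polynomial.monic_X_pow_add ?_
      refine (Polynomial.degree_sum_le _ _).trans_lt ?_
      refine (Finset.sup_lt_iff (WithBot.bot_lt_coe t)).2 ?_
      intro j hj
      refine (Polynomial.degree_C_mul_X_pow_le _ _).trans_lt ?_
      have := Finset.mem_Icc.1 hj
      exact Nat.cast_lt.2 (by omega : t - j < t)
    have hx : IsIntegral A (φ r / φ g) := by
      refine ⟨p, hp, ?_⟩
      have e := congrArg φ h
      simp only [map_add, map_pow, map_sum, map_mul, map_zero] at e
      simp only [p, Polynomial.eval₂_add, Polynomial.eval₂_pow, Polynomial.eval₂_X,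
        Polynomial.eval₂_finsetSum, Polynomial.eval₂_mul, Polynomial.eval₂_C]
      have hpow : φ g ^ t ≠ 0 := pow_ne_zero _ hg'
      apply mul_left_cancel₀ hpow
      rw [mul_zero, ← e, mul_add, Finset.mul_sum]
      congr 1
      · rw [← mul_pow, mul_div_cancel₀ _ hg']
      · refine Finset.sum_congr rfl fun j hj => ?_
        have hj' := (Finset.mem_Icc.1 hj).2
        have e1 : φ g ^ t = φ g ^ j * φ g ^ (t - j) := by
          rw [← pow_add]; congr 1; omega
        have e2 : φ g ^ (t - j) * (φ r / φ g) ^ (t - j) = φ r ^ (t - j) := by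
          rw [← mul_pow, mul_div_cancel₀ _ hg']
        rw [← e2, e1]
        change φ g ^ j * φ g ^ (t - j) * (φ (b j) * (φ r / φ g) ^ (t - j)) = _
        ring
    obtain ⟨y, hy⟩ := IsIntegrallyClosed.isIntegral_iff.1 hx
    refine ⟨y, IsFractionRing.injective A K ?_⟩
    rw [map_mul, hy]
    exact (mul_div_cancel₀ _ hg').symm

theorem pid_of_height_one {R : Type} [CommRing R] [IsDomain R] [IsNoetherianRing R]
    [IsIntegrallyClosed R] (P : Ideal R) [P.IsPrime] (hP : idealHeight P = 1) :
    IsPrincipalIdealRing (Localization.AtPrime P) := by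
  have hh : Order.height (⟨P, inferInstance⟩ : PrimeSpectrum R) ≤ 1 := by
    rw [← hP]
    refine le_iInf₂ fun q hq => Order.height_mono ?_
    exact hq
  have : IsDomain (Localization.AtPrime P) := inferInstance
  have : IsNoetherianRing (Localization.AtPrime P) := inferInstance
  have : IsIntegrallyClosed (Localization.AtPrime P) :=
    isIntegrallyClosed_of_isLocalization _ P.primeCompl P.primeCompl_le_nonZeroDivisors
  have htf : (IsIntegrallyClosed (Localization.AtPrime P) ∧
      ∀ Q : Ideal (Localization.AtPrime P), Q ≠ ⊥ → Q.IsPrime → Q = maximalIdeal _) →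
      IsPrincipalIdealRing (Localization.AtPrime P) :=
    ((tfae_of_isNoetherianRing_of_isLocalRing_of_isDomain (Localization.AtPrime P)).out 3 0).1
  refine htf ⟨this, fun Q hQ hQp => ?_⟩
  let φ := algebraMap R (Localization.AtPrime P)
  have hφ : Function.Injective φ :=
    IsLocalization.injective _ P.primeCompl_le_nonZeroDivisors
  have hQc : (Q.comap φ).IsPrime := Ideal.IsPrime.comap φ
  have hle : Q.comap φ ≤ P := by
    have h2 := Ideal.comap_mono (f := φ) (IsLocalRing.le_maximalIdeal hQp.ne_top)
    exact h2.trans (le_of_eq Localization.AtPrime.under_maximalIdeal)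
  have hne : Q.comap φ ≠ ⊥ := by
    intro h0
    apply hQ
    rw [← IsLocalization.map_under P.primeCompl _ Q]
    change Ideal.map φ (Q.comap φ) = ⊥
    rw [h0, Ideal.map_bot]
  have heq : Q.comap φ = P := by
    by_contra hne'
    let q0 : PrimeSpectrum R := ⟨⊥, Ideal.isPrime_bot⟩
    let q1 : PrimeSpectrum R := ⟨Q.comap φ, hQc⟩
    let q2 : PrimeSpectrum R := ⟨P, inferInstance⟩
    have l01 : q0 < q1 :=
      lt_of_le_of_ne (show (⊥ : Ideal R) ≤ Q.comap φ from bot_le)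
        fun h => hne (congrArg PrimeSpectrum.asIdeal h).symm
    have l12 : q1 < q2 := lt_of_le_of_ne (show Q.comap φ ≤ P from hle)
        fun h => hne' (congrArg PrimeSpectrum.asIdeal h)
    have e1 := Order.height_add_one_le l01
    have e2 := Order.height_add_one_le l12
    have e3 : Order.height q1 + 1 ≤ 0 + 1 := (e2.trans hh).trans (by simp)
    have e4 : Order.height q1 ≤ 0 := by
      rwa [ENat.add_le_add_iff_right (by simp)] at e3
    have e5 := e1.trans e4
    simp at e5
  have h3 := IsLocalization.map_under P.primeCompl (Localization.AtPrime P) Q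
  rw [← h3]
  change Ideal.map φ (Q.comap φ) = _
  rw [heq]
  exact Localization.AtPrime.map_eq_maximalIdeal

theorem intCl_le_symb {R : Type} [CommRing R] [IsDomain R] [IsNoetherianRing R]
    [IsIntegrallyClosed R] (I : Ideal R) (hI : PureHeightOne I) (n : ℕ) (r : R)
    (hr : memIntCl (I ^ n) r) : r ∈ symb I n := by
  have h1 : ∀ P ∈ I.minimalPrimes, ∃ s, s ∉ P ∧ s * r ∈ I ^ n := by
    intro P hP
    have hPp : P.IsPrime := hP.1.1
    have := pid_of_height_one P (hI.2.2 P hP)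
    have : IsIntegrallyClosed (Localization.AtPrime P) := inferInstance
    let φ := algebraMap R (Localization.AtPrime P)
    obtain ⟨t, ht, a, ha, he⟩ := hr
    obtain ⟨g, hg⟩ := (IsPrincipalIdealRing.principal (Ideal.map φ (I ^ n))).principal
    have hb : ∀ j, ∃ c, 1 ≤ j → j ≤ t → φ (a j) = c * g ^ j := by
      intro j
      by_cases hj : 1 ≤ j ∧ j ≤ t
      · have h2 := Ideal.mem_map_of_mem φ (ha j hj.1 hj.2)
        rw [Ideal.map_pow, hg, Ideal.submodule_span_eq, Ideal.span_singleton_pow,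
          Ideal.mem_span_singleton] at h2
        obtain ⟨c, hc⟩ := h2
        exact ⟨c, fun _ _ => hc.trans (mul_comm _ _)⟩
      · exact ⟨0, fun h1 h2 => absurd ⟨h1, h2⟩ hj⟩
    choose b hb using hb
    have hd : g ∣ φ r := by
      refine dvd_of_intEq g (φ r) t ht b ?_
      rw [← map_zero φ, ← he, map_add, map_sum, map_pow]
      congr 1
      refine Finset.sum_congr rfl fun j hj => ?_
      have := Finset.mem_Icc.1 hj
      rw [map_mul, map_pow, hb j this.1 this.2]
    have hm : φ r ∈ Ideal.map φ (I ^ n) := by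
      rw [hg, Ideal.submodule_span_eq]
      exact Ideal.mem_span_singleton.2 hd
    obtain ⟨s, hs, hsr⟩ :=
      (IsLocalization.algebraMap_mem_map_algebraMap_iff P.primeCompl _ (I ^ n) r).1 hm
    exact ⟨s, hs, hsr⟩
  have hfin := Ideal.finite_minimalPrimes_of_isNoetherianRing R I
  let C : Ideal R := Submodule.comap (LinearMap.mulRight R r) (I ^ n)
  by_contra hcon
  have hsub : (C : Set R) ⊆ ⋃ P ∈ (↑hfin.toFinset : Set (Ideal R)), (P : Set R) := by
    intro s hs
    by_contra hs'
    refine hcon ⟨s, fun P hP hsP => hs' ?_, hs⟩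
    exact Set.mem_biUnion (by simpa using hP) hsP
  obtain ⟨P, hP, hle⟩ := (Ideal.subset_union_prime (f := fun P : Ideal R => P) ⊥ ⊥
    (fun P hP _ _ => ((hfin.mem_toFinset).1 hP).1.1)).1 hsub
  obtain ⟨s, hs, hsr⟩ := h1 P (hfin.mem_toFinset.1 hP)
  exact hs (hle hsr)

theorem pow_le_symb_tors {R : Type} [CommRing R] [IsLocalRing R] [IsNoetherianRing R]
    (I : Ideal R) (n : ℕ)
    (hloc : ∀ (P : PrimeSpectrum R), P.asIdeal ≠ maximalIdeal R →
      Ideal.map (algebraMap R (Localization.AtPrime P.asIdeal)) (I ^ n) =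
        Ideal.map (algebraMap R (Localization.AtPrime P.asIdeal)) (symb I n)) (r : R)
    (hr : r ∈ symb I n) : ∃ k, ∀ a ∈ maximalIdeal R ^ k, a * r ∈ I ^ n := by
  let C : Ideal R := Submodule.comap (LinearMap.mulRight R r) (I ^ n)
  have hle : maximalIdeal R ≤ C.radical := by
    rw [Ideal.radical_eq_sInf]
    refine le_sInf ?_
    rintro P ⟨hCP, hP⟩
    by_contra hne
    have hPm : P ≠ maximalIdeal R := fun h => hne h.ge
    have h2 := Ideal.mem_map_of_mem (algebraMap R (Localization.AtPrime P)) hr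
    rw [← hloc ⟨P, hP⟩ hPm] at h2
    obtain ⟨s, hs, hsr⟩ :=
      (IsLocalization.algebraMap_mem_map_algebraMap_iff P.primeCompl _ (I ^ n) r).1 h2
    exact hs (hCP hsr)
  obtain ⟨k, hk⟩ := Ideal.exists_pow_le_of_le_radical_of_fg hle (IsNoetherian.noetherian _)
  exact ⟨k, fun a ha => hk ha⟩

theorem finLen_of_kill {R : Type} [CommRing R] [IsLocalRing R] [IsNoetherianRing R]
    {M : Type} [AddCommGroup M] [Module R M] [Module.Finite R M] (k : ℕ)
    (hk : ∀ a ∈ maximalIdeal R ^ k, ∀ x : M, a • x = 0) : IsFiniteLength R M := by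
  have hA : IsArtinianRing (R ⧸ maximalIdeal R ^ k) := by
    rw [isArtinianRing_iff_krullDimLE_zero, Ring.krullDimLE_zero_iff]
    intro Q hQ
    let π := Ideal.Quotient.mk (maximalIdeal R ^ k)
    have h1 : maximalIdeal R ≤ Q.comap π := by
      intro x hx
      have h2 : π (x ^ k) = 0 := Ideal.Quotient.eq_zero_iff_mem.2 (Ideal.pow_mem_pow hx k)
      have h3 : x ^ k ∈ Q.comap π := by
        rw [Ideal.mem_comap, h2]; exact Q.zero_mem
      exact (Ideal.IsPrime.comap π).mem_of_pow_mem k h3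
    have hne : Q.comap π ≠ ⊤ := (Ideal.IsPrime.comap π).ne_top
    have h4 : maximalIdeal R = Q.comap π :=
      (IsLocalRing.maximalIdeal.isMaximal R).eq_of_le hne h1
    have h5 : (Q.comap π).IsMaximal := h4 ▸ IsLocalRing.maximalIdeal.isMaximal R
    have h6 := Ideal.map_comap_of_surjective π Ideal.Quotient.mk_surjective Q
    have h7 := Ideal.map_eq_top_or_isMaximal_of_surjective π Ideal.Quotient.mk_surjective h5
    rw [h6] at h7
    exact h7.resolve_left hQ.ne_top
  have hT : Module.IsTorsionBySet R M (maximalIdeal R ^ k : Ideal R) := fun x a => hk a a.2 x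
  let _ := hT.module
  have : IsScalarTower R (R ⧸ maximalIdeal R ^ k) M := hT.isScalarTower
  have : Module.Finite (R ⧸ maximalIdeal R ^ k) M := Module.Finite.of_restrictScalars_finite R _ _
  have : IsArtinian (R ⧸ maximalIdeal R ^ k) M := inferInstance
  rw [isFiniteLength_iff_isNoetherian_isArtinian]
  exact ⟨inferInstance,
    isArtinian_of_surjective_algebraMap (R := R ⧸ maximalIdeal R ^ k) Ideal.Quotient.mk_surjective⟩

end CAHelpers

/-- Let `(R,𝔪)` be a Noetherian local normal domain and `I` an ideal of pure height one
with `Iⁿ R_P = I^{(n)} R_P` for all `n` and all non-maximal primes `P`.  Then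
`I^{(n)}/\overline{Iⁿ}` has finite length and `H^i_𝔪(R/\overline{Iⁿ}) ≅ H^i_𝔪(R/I^{(n)})`
for all `i ≥ 1`. -/
theorem symbolic_vs_integral_closure_local_cohomology {R : Type} [CommRing R] [IsLocalRing R]
    [IsNoetherianRing R] [IsDomain R] [IsIntegrallyClosed R]
    (I : Ideal R) (hI : PureHeightOne I)
    (hloc : ∀ (n : ℕ) (P : PrimeSpectrum R), P.asIdeal ≠ maximalIdeal R →
      Ideal.map (algebraMap R (Localization.AtPrime P.asIdeal)) (I ^ n) =
        Ideal.map (algebraMap R (Localization.AtPrime P.asIdeal)) (symb I n))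
    (Jbar : ℕ → Ideal R) (hJbar : ∀ (n : ℕ) (r : R), r ∈ Jbar n ↔ memIntCl (I ^ n) r) :
    ∀ n : ℕ, 1 ≤ n →
      IsFiniteLength R
        (↥(symb I n) ⧸ Submodule.comap (symb I n).subtype (Jbar n)) ∧
      ∀ i : ℕ, 1 ≤ i →
        Nonempty (((localCohomology (maximalIdeal R) i).obj (ModuleCat.of R (R ⧸ Jbar n))) ≅
          ((localCohomology (maximalIdeal R) i).obj (ModuleCat.of R (R ⧸ symb I n)))) := by
  intro n _
  have hle : Jbar n ≤ symb I n := fun r hr => intCl_le_symb I hI n r ((hJbar n r).1 hr)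
  have hge : I ^ n ≤ Jbar n := by
    intro r hr
    rw [hJbar]
    refine ⟨1, Nat.one_pos, fun _ => -r, fun j h1 h2 => ?_, by simp⟩
    obtain rfl : j = 1 := le_antisymm h2 h1
    rw [pow_one]
    exact neg_mem hr
  have htors : ∀ r ∈ symb I n, ∃ k, ∀ a ∈ maximalIdeal R ^ k, a * r ∈ Jbar n := by
    intro r hr
    obtain ⟨k, hk⟩ := pow_le_symb_tors I n (hloc n) r hr
    exact ⟨k, fun a ha => hge (hk a ha)⟩
  refine ⟨?_, ?_⟩
  · have hT : TorsJ (maximalIdeal R)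
        (↥(symb I n) ⧸ Submodule.comap (symb I n).subtype (Jbar n)) := by
      intro x
      obtain ⟨⟨r, hr⟩, rfl⟩ := Submodule.Quotient.mk_surjective _ x
      obtain ⟨k, hk⟩ := htors r hr
      refine ⟨k, fun a ha => ?_⟩
      rw [← Submodule.Quotient.mk_smul, Submodule.Quotient.mk_eq_zero]
      exact hk a ha
    obtain ⟨c, hc⟩ := tors_uniform (maximalIdeal R) hT LinearMap.id
    exact finLen_of_kill c hc
  · intro i hi
    obtain ⟨j, rfl⟩ : ∃ j, i = j + 1 := ⟨i - 1, by omega⟩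
    let p : ModuleCat.of R (R ⧸ Jbar n) ⟶ ModuleCat.of R (R ⧸ symb I n) :=
      ModuleCat.ofHom (Submodule.mapQ (Jbar n) (symb I n) LinearMap.id hle)
    have hb := lc_bij (maximalIdeal R) j p
      (by
        intro y
        obtain ⟨r, rfl⟩ := Submodule.Quotient.mk_surjective _ y
        exact ⟨Submodule.Quotient.mk r, rfl⟩)
      (by
        intro x hx
        obtain ⟨r, rfl⟩ := Submodule.Quotient.mk_surjective _ x
        have hr : r ∈ symb I n := (Submodule.Quotient.mk_eq_zero _).1 hx
        obtain ⟨k, hk⟩ := htors r hr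
        refine ⟨k, fun a ha => ?_⟩
        exact (Submodule.Quotient.mk_eq_zero (Jbar n)).2 (hk a ha))
    exact ⟨(LinearEquiv.ofBijective
      ((localCohomology (maximalIdeal R) (j + 1)).map p).hom hb).toModuleIso⟩

end
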